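/- Under the strict Hall condition, the algorithm's Markov process restricted to complete allocation states is ergodic and time-reversible with unique invariant probability μ_γ(W) = (α choose W) e^{γΨ(W)} / ∑_{W'} (α choose W') e^{γΨ(W')}; moreover as γ → ∞, μ_γ converges to the probability measure μ_∞ supported on argmax_W Ψ(W) with μ_∞(W) ∝ (α choose W). -/

import Mathlib

open scoped Classical

variable {X : Type*} [Fintype X]

/-- Column sum. -/
def colsum (W : X → X → ℕ) (y : X) : ℕ := ∑ x, W x y

/-- Utility `f_{xy}(W)`. -/
noncomputable def payoff (lam : X → ℝ) (kc ka : ℝ) (β : X → ℕ)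
    (W : X → X → ℕ) (x y : X) : ℝ :=
  lam y - kc * (colsum W y : ℝ) / (β y : ℝ) + ka * (W x y : ℝ)

/-- Potential `Ψ`. -/
noncomputable def potential (lam : X → ℝ) (kc ka : ℝ) (β : X → ℕ)
    (W : X → X → ℕ) : ℝ :=
  (∑ y, ∑ s ∈ Finset.range (colsum W y + 1), (lam y - kc * (s : ℝ) / (β y : ℝ)))
    + ka * ∑ x, ∑ y, ∑ s ∈ Finset.range (W x y + 1), (s : ℝ)

/-- Complete allocation state. -/
def IsAllocState (E : X → X → Prop) (α β : X → ℕ) (W : X → X → ℕ) : Prop :=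
  (∀ x y, ¬ E x y → W x y = 0) ∧ (∀ x, ∑ y, W x y = α x) ∧ ∀ y, colsum W y ≤ β y

/-- `W − e_{xy} + e_{xy'}`. -/
def move [DecidableEq X] (W : X → X → ℕ) (x y y' : X) : X → X → ℕ :=
  fun u v => W u v - (if u = x ∧ v = y then 1 else 0)
    + (if u = x ∧ v = y' then 1 else 0)

/-- `W − e_{xy}`. -/
def remove [DecidableEq X] (W : X → X → ℕ) (x y : X) : X → X → ℕ :=
  fun u v => W u v - if u = x ∧ v = y then 1 else 0

/-- `(α choose W) = (∏_x α_x!)/(∏_{x,y} W_{xy}!)`. -/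
noncomputable def multi (α : X → ℕ) (W : X → X → ℕ) : ℝ :=
  (∏ x, (α x).factorial : ℝ) / (∏ x, ∏ y, (W x y).factorial : ℝ)

/-- `W + e_{xy}`. -/
def addUnit [DecidableEq X] (W : X → X → ℕ) (x y : X) : X → X → ℕ :=
  fun u v => W u v + if u = x ∧ v = y then 1 else 0

lemma move_eq_addUnit_remove {Y : Type*} [DecidableEq Y] (W : Y → Y → ℕ) (x y y' : Y) :
    move W x y y' = addUnit (remove W x y) x y' := rfl

lemma addUnit_remove {Y : Type*} [DecidableEq Y] {W : Y → Y → ℕ} {x y : Y} (h : 0 < W x y) :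
    addUnit (remove W x y) x y = W := by
  funext u v
  simp only [addUnit, remove]
  split_ifs with huv
  · obtain ⟨rfl, rfl⟩ := huv
    omega
  · omega

lemma remove_addUnit {Y : Type*} [DecidableEq Y] (W : Y → Y → ℕ) (x y : Y) :
    remove (addUnit W x y) x y = W := by
  funext u v
  simp [addUnit, remove]

lemma remove_move {Y : Type*} [DecidableEq Y] (W : Y → Y → ℕ) (x y y' : Y) :
    remove (move W x y y') x y' = remove W x y := by
  rw [move_eq_addUnit_remove, remove_addUnit]

lemma move_apply_self {Y : Type*} [DecidableEq Y] (W : Y → Y → ℕ) {x y y' : Y} (hy : y ≠ y') :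
    move W x y y' x y' = W x y' + 1 := by
  simp [move, hy.symm]

lemma move_move {Y : Type*} [DecidableEq Y] {W : Y → Y → ℕ} {x y : Y} (y' : Y) (h : 0 < W x y) :
    move (move W x y y') x y' y = W := by
  rw [move_eq_addUnit_remove (move W x y y'), remove_move, addUnit_remove h]

lemma colsum_addUnit [DecidableEq X] (W : X → X → ℕ) (x y v : X) :
    colsum (addUnit W x y) v = colsum W v + if v = y then 1 else 0 := by
  simp only [colsum, addUnit, Finset.sum_add_distrib]
  congr 1
  by_cases hv : v = y <;> simp [hv]

lemma rowsum_addUnit [DecidableEq X] (W : X → X → ℕ) (x y u : X) :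
    ∑ v, addUnit W x y u v = ∑ v, W u v + if u = x then 1 else 0 := by
  simp only [addUnit, Finset.sum_add_distrib]
  congr 1
  by_cases hu : u = x <;> simp [hu]

lemma colsum_move [DecidableEq X] {W : X → X → ℕ} {x y : X} (y' v : X) (h : 0 < W x y) :
    colsum (move W x y y') v + (if v = y then 1 else 0) =
      colsum W v + if v = y' then 1 else 0 := by
  have h1 := colsum_addUnit (remove W x y) x y v
  rw [addUnit_remove h] at h1
  rw [move_eq_addUnit_remove, colsum_addUnit, h1]
  omega

lemma rowsum_move [DecidableEq X] {W : X → X → ℕ} {x y : X} (y' u : X) (h : 0 < W x y) :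
    ∑ v, move W x y y' u v = ∑ v, W u v := by
  have h1 := rowsum_addUnit (remove W x y) x y u
  rw [addUnit_remove h] at h1
  rw [move_eq_addUnit_remove, rowsum_addUnit, h1]

/-- Double products of two functions that agree away from `(x, y)`. -/
@[to_additive]
lemma prod_prod_mul_apply_comm [DecidableEq X] {M : Type*} [CommMonoid M] {g h : X → X → M}
    (x y : X) (hgh : ∀ u v, ¬ (u = x ∧ v = y) → g u v = h u v) :
    (∏ u, ∏ v, g u v) * h x y = (∏ u, ∏ v, h u v) * g x y := by
  rw [← Fintype.prod_prod_type', ← Fintype.prod_prod_type',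
    ← Finset.mul_prod_erase _ (fun p : X × X => g p.1 p.2) (Finset.mem_univ (x, y)),
    ← Finset.mul_prod_erase _ (fun p : X × X => h p.1 p.2) (Finset.mem_univ (x, y))]
  have : ∏ p ∈ Finset.univ.erase (x, y), g p.1 p.2 =
      ∏ p ∈ Finset.univ.erase (x, y), h p.1 p.2 := by
    refine Finset.prod_congr rfl fun p hp => hgh _ _ ?_
    rintro ⟨h1, h2⟩
    exact (Finset.mem_erase.1 hp).1 (Prod.ext h1 h2)
  rw [this]
  dsimp only
  ac_rfl

lemma potential_addUnit [DecidableEq X] (lam : X → ℝ) (kc ka : ℝ) (β : X → ℕ)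
    (W : X → X → ℕ) (x y : X) :
    potential lam kc ka β (addUnit W x y) =
      potential lam kc ka β W + payoff lam kc ka β (addUnit W x y) x y := by
  have h1 : ∑ v, ∑ s ∈ Finset.range (colsum (addUnit W x y) v + 1),
        (lam v - kc * (s : ℝ) / (β v : ℝ)) =
      ∑ v, ∑ s ∈ Finset.range (colsum W v + 1), (lam v - kc * (s : ℝ) / (β v : ℝ)) +
        (lam y - kc * (colsum (addUnit W x y) y : ℝ) / (β y : ℝ)) := by
    rw [← Finset.sum_erase_add _ _ (Finset.mem_univ y),
      ← Finset.sum_erase_add (a := y) _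
        (fun v => ∑ s ∈ Finset.range (colsum W v + 1), (lam v - kc * (s : ℝ) / (β v : ℝ)))
        (Finset.mem_univ y), add_assoc]
    congr 1
    · refine Finset.sum_congr rfl fun v hv => ?_
      simp [colsum_addUnit, Finset.ne_of_mem_erase hv]
    · simp [colsum_addUnit, Finset.sum_range_succ _ (colsum W y + 1)]
  have h2 := sum_sum_add_apply_comm
    (g := fun u v => ∑ s ∈ Finset.range (addUnit W x y u v + 1), (s : ℝ))
    (h := fun u v => ∑ s ∈ Finset.range (W u v + 1), (s : ℝ)) x y
    (fun u v huv => by simp [addUnit, huv])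
  have h3 : addUnit W x y x y = W x y + 1 := by simp [addUnit]
  simp only [h3, Finset.sum_range_succ _ (W x y + 1)] at h2
  simp only [potential, payoff, h1, h3]
  linear_combination ka * h2

lemma multi_pos (α : X → ℕ) (W : X → X → ℕ) : 0 < multi α W := by
  unfold multi
  positivity

lemma multi_addUnit [DecidableEq X] (α : X → ℕ) (W : X → X → ℕ) (x y : X) :
    multi α (addUnit W x y) * (addUnit W x y x y : ℝ) = multi α W := by
  have h := prod_prod_mul_apply_comm
    (g := fun u v => ((addUnit W x y u v).factorial : ℝ))
    (h := fun u v => ((W u v).factorial : ℝ)) x y (fun u v huv => by simp [addUnit, huv])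
  have h3 : addUnit W x y x y = W x y + 1 := by simp [addUnit]
  simp only [h3, Nat.factorial_succ] at h
  have h4 : ((W x y).factorial : ℝ) ≠ 0 := by positivity
  have h5 : (∏ u, ∏ v, ((addUnit W x y u v).factorial : ℝ)) =
      (∏ u, ∏ v, ((W u v).factorial : ℝ)) * ((W x y : ℝ) + 1) := by
    apply mul_right_cancel₀ h4
    rw [h]
    push_cast
    ring
  unfold multi
  rw [h5, h3]
  have h6 : (∏ u, ∏ v, ((W u v).factorial : ℝ)) ≠ 0 := by positivity
  have h7 : (W x y : ℝ) + 1 ≠ 0 := by positivity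
  push_cast
  field_simp

lemma isAllocState_move [DecidableEq X] {E : X → X → Prop} {α β : X → ℕ} {W : X → X → ℕ}
    {x y y' : X} (hW : IsAllocState E α β W) (hy : y ≠ y') (h : 0 < W x y) (hE : E x y')
    (hc : colsum W y' < β y') : IsAllocState E α β (move W x y y') := by
  refine ⟨fun u v huv => ?_, fun u => ?_, fun v => ?_⟩
  · have : ¬ (u = x ∧ v = y') := by
      rintro ⟨rfl, rfl⟩
      exact huv hE
    simp [move, this, hW.1 u v huv]
  · rw [rowsum_move _ _ h, hW.2.1]
  · have h1 := colsum_move y' v h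
    have h2 := hW.2.2 v
    by_cases hv : v = y'
    · subst hv
      simp only [hy.symm, if_true, if_false] at h1
      omega
    · simp only [hv, if_false] at h1
      omega

/-- One distribution move between complete allocation states. -/
def DistMove [DecidableEq X] (E : X → X → Prop) (α β : X → ℕ) (A B : X → X → ℕ) : Prop :=
  IsAllocState E α β A ∧ IsAllocState E α β B ∧
    ∃ x y y', y ≠ y' ∧ 0 < A x y ∧ colsum A y' < β y' ∧ B = move A x y y'

/-- If a move of `W` is a state, it goes to a column with spare capacity. -/
lemma colsum_lt_of_isAllocState_move [DecidableEq X] {E : X → X → Prop} {α β : X → ℕ}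
    {W : X → X → ℕ} {x y y' : X} (hW' : IsAllocState E α β (move W x y y')) (hy : y ≠ y')
    (h : 0 < W x y) : colsum W y' < β y' := by
  have h1 := colsum_move y' y' h
  simp only [hy.symm, if_true, if_false] at h1
  have := hW'.2.2 y'
  omega

lemma colsum_move_lt [DecidableEq X] {E : X → X → Prop} {α β : X → ℕ}
    {W : X → X → ℕ} {x y y' : X} (hW : IsAllocState E α β W) (hy : y ≠ y')
    (h : 0 < W x y) : colsum (move W x y y') y < β y := by
  have h1 := colsum_move y' y h
  simp only [hy, if_true, if_false] at h1
  have := hW.2.2 y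
  omega

lemma DistMove.symm [DecidableEq X] {E : X → X → Prop} {α β : X → ℕ} {A B : X → X → ℕ}
    (h : DistMove E α β A B) : DistMove E α β B A := by
  obtain ⟨hA, hB, x, y, y', hy, hpos, hc, rfl⟩ := h
  refine ⟨hB, hA, x, y', y, hy.symm, ?_, colsum_move_lt hA hy hpos, (move_move _ hpos).symm⟩
  rw [move_apply_self _ hy]
  omega

lemma reflTransGen_distMove_symm [DecidableEq X] {E : X → X → Prop} {α β : X → ℕ}
    {A B : X → X → ℕ} (h : Relation.ReflTransGen (DistMove E α β) A B) :
    Relation.ReflTransGen (DistMove E α β) B A := by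
  induction h with
  | refl => exact .refl
  | tail _ hbc ih => exact .head hbc.symm ih

/-- The `ℓ¹` distance between states. -/
def l1dist (A B : X → X → ℕ) : ℕ := ∑ x, ∑ y, ((A x y : ℤ) - B x y).natAbs

lemma l1dist_comm (A B : X → X → ℕ) : l1dist A B = l1dist B A := by
  simp only [l1dist]
  exact Finset.sum_congr rfl fun x _ => Finset.sum_congr rfl fun y _ => by omega

lemma l1dist_addUnit [DecidableEq X] (A B : X → X → ℕ) (x y : X) :
    l1dist (addUnit A x y) B + ((A x y : ℤ) - B x y).natAbs =
      l1dist A B + ((A x y + 1 : ℤ) - B x y).natAbs := by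
  have := sum_sum_add_apply_comm
    (g := fun u v => ((addUnit A x y u v : ℤ) - B u v).natAbs)
    (h := fun u v => ((A u v : ℤ) - B u v).natAbs) x y (fun u v huv => by simp [addUnit, huv])
  simpa [l1dist, addUnit] using this

/-- Moving a unit out of an entry exceeding `B` does not increase the distance to `B`. -/
lemma l1dist_move_le [DecidableEq X] {A B : X → X → ℕ} {x y y' : X} (h : B x y < A x y) :
    l1dist (move A x y y') B ≤ l1dist A B := by
  have h1 := l1dist_addUnit (remove A x y) B x y
  rw [addUnit_remove (by omega)] at h1
  have h2 := l1dist_addUnit (remove A x y) B x y'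
  rw [← move_eq_addUnit_remove] at h2
  have h3 : remove A x y x y = A x y - 1 := by simp [remove]
  rw [h3] at h1
  omega

lemma l1dist_move_lt [DecidableEq X] {A B : X → X → ℕ} {x y y' : X} (h : B x y < A x y)
    (h' : A x y' < B x y') : l1dist (move A x y y') B < l1dist A B := by
  have h1 := l1dist_addUnit (remove A x y) B x y
  rw [addUnit_remove (by omega)] at h1
  have h2 := l1dist_addUnit (remove A x y) B x y'
  rw [← move_eq_addUnit_remove] at h2
  have h3 : remove A x y x y = A x y - 1 := by simp [remove]
  have h4 : remove A x y x y' ≤ A x y' := by simp [remove]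
  rw [h3] at h1
  omega

lemma move_sub_move {Y : Type*} [DecidableEq Y] {A B : Y → Y → ℕ} {x y : Y} (y' : Y) (hA : 0 < A x y)
    (hB : 0 < B x y) (u v : Y) :
    (move A x y y' u v : ℤ) - move B x y y' u v = A u v - B u v := by
  by_cases h : u = x ∧ v = y
  · obtain ⟨rfl, rfl⟩ := h
    simp only [move, and_self, if_true]
    omega
  · simp [move, h]

lemma l1dist_move_move [DecidableEq X] {A B : X → X → ℕ} {x y : X} (y' : X) (hA : 0 < A x y)
    (hB : 0 < B x y) : l1dist (move A x y y') (move B x y y') = l1dist A B := by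
  simp only [l1dist, move_sub_move y' hA hB]

lemma exists_lt_of_sum_eq {f g : X → ℕ} (h : ∑ i, f i = ∑ i, g i) {i : X} (hi : f i < g i) :
    ∃ j, g j < f j := by
  by_contra! hle
  exact absurd h (Finset.sum_lt_sum (fun j _ => hle j) ⟨i, Finset.mem_univ _, hi⟩).ne

lemma full_of_lt [DecidableEq X] {E : X → X → Prop} {α β : X → ℕ} {A B : X → X → ℕ}
    (ih : ∀ A' B', IsAllocState E α β A' → IsAllocState E α β B' → l1dist A' B' < l1dist A B →
      Relation.ReflTransGen (DistMove E α β) A' B')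
    (hA : IsAllocState E α β A) (hB : IsAllocState E α β B)
    (hAB : ¬ Relation.ReflTransGen (DistMove E α β) A B) {x y : X} (hxy : A x y < B x y) :
    colsum A y = β y := by
  by_contra hne
  have hlt : colsum A y < β y := lt_of_le_of_ne (hA.2.2 y) hne
  obtain ⟨z, hz⟩ := exists_lt_of_sum_eq ((hA.2.1 x).trans (hB.2.1 x).symm) hxy
  have hzy : z ≠ y := by
    rintro rfl
    omega
  have hE : E x y := by
    by_contra hE
    have := hB.1 x y hE
    omega
  have hpos : 0 < A x z := by omega
  have hA' := isAllocState_move hA hzy hpos hE hlt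
  exact hAB (.head ⟨hA, hA', x, z, y, hzy, hpos, hlt, rfl⟩
    (ih _ _ hA' hB (l1dist_move_lt hz hxy)))

/-- At minimal distance, a column where two disconnected states differ is full in the first state,
which is exceeded there by the second. -/
lemma full_of_ne [DecidableEq X] {E : X → X → Prop} {α β : X → ℕ} {A B : X → X → ℕ}
    (ih : ∀ A' B', IsAllocState E α β A' → IsAllocState E α β B' → l1dist A' B' < l1dist A B →
      Relation.ReflTransGen (DistMove E α β) A' B')
    (hA : IsAllocState E α β A) (hB : IsAllocState E α β B)
    (hAB : ¬ Relation.ReflTransGen (DistMove E α β) A B) {x y : X} (hxy : A x y ≠ B x y) :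
    colsum A y = β y ∧ ∃ u, A u y < B u y := by
  suffices h : ∃ u, A u y < B u y from ⟨full_of_lt ih hA hB hAB h.choose_spec, h⟩
  by_contra! hle
  have hlt : B x y < A x y := lt_of_le_of_ne (hle x) hxy.symm
  have hfull : colsum B y = β y := by
    refine full_of_lt (A := B) (B := A) (fun A' B' hA' hB' hd => ?_) hB hA
      (fun h => hAB (reflTransGen_distMove_symm h)) hlt
    rw [l1dist_comm B A] at hd
    exact ih A' B' hA' hB' hd
  have : colsum B y < colsum A y :=
    Finset.sum_lt_sum (fun u _ => hle u) ⟨x, Finset.mem_univ _, hlt⟩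
  have := hA.2.2 y
  omega

/-- Walks of length `n` between columns, a step going from a column `v` to a column admissible for
a row that uses `v`. -/
def ColWalk (E : X → X → Prop) (A : X → X → ℕ) : ℕ → X → X → Prop
  | 0, y, w => y = w
  | n + 1, y, w => ∃ v x, ColWalk E A n y v ∧ 0 < A x v ∧ E x w

lemma ColWalk.of_le_off {Y : Type*} {E : Y → Y → Prop} {A A' : Y → Y → ℕ} {v : Y}
    (h : ∀ u t, t ≠ v → A u t ≤ A' u t) {n : ℕ} {y w : Y} (hw : ColWalk E A n y w) :
    ∃ m ≤ n, ColWalk E A' m y v ∨ ColWalk E A' m y w := by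
  induction n generalizing w with
  | zero => exact ⟨0, le_rfl, Or.inr hw⟩
  | succ n ih =>
    obtain ⟨t, x, ht, hpos, hE⟩ := hw
    obtain ⟨m, hm, h1 | h1⟩ := ih ht
    · exact ⟨m, by omega, Or.inl h1⟩
    · by_cases htv : t = v
      · exact ⟨m, by omega, Or.inl (htv ▸ h1)⟩
      · exact ⟨m + 1, by omega, Or.inr ⟨t, x, h1, hpos.trans_le (h x t htv), hE⟩⟩

lemma not_colWalk_of_ne [DecidableEq X] {E : X → X → Prop} {α β : X → ℕ} {d : ℕ}
    (ih : ∀ A' B', IsAllocState E α β A' → IsAllocState E α β B' → l1dist A' B' < d →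
      Relation.ReflTransGen (DistMove E α β) A' B') (n : ℕ) :
    ∀ A B, IsAllocState E α β A → IsAllocState E α β B → l1dist A B = d →
      ¬ Relation.ReflTransGen (DistMove E α β) A B → ∀ x₀ y w, A x₀ y ≠ B x₀ y →
      colsum A w < β w → ¬ ColWalk E A n y w := by
  induction n using Nat.strong_induction_on with
  | _ n ihn =>
  rintro A B hA hB rfl hAB x₀ y w hne hlt hwalk
  cases n with
  | zero =>
    obtain rfl : y = w := hwalk
    exact hlt.ne (full_of_ne ih hA hB hAB hne).1
  | succ n =>
    obtain ⟨v, x, hv, hpos, hE⟩ := hwalk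
    have hw : ∀ u, A u w = B u w := fun u => by
      by_contra h
      exact hlt.ne (full_of_ne ih hA hB hAB h).1
    by_cases hvw : v = w
    · subst hvw
      exact ihn n (by omega) A B hA hB rfl hAB x₀ y v hne hlt hv
    have hA' := isAllocState_move hA hvw hpos hE hlt
    have hAA' : DistMove E α β A (move A x v w) := ⟨hA, hA', x, v, w, hvw, hpos, hlt, rfl⟩
    have hv' := colsum_move_lt hA hvw hpos
    by_cases hBpos : 0 < B x v
    · have hltB : colsum B w < β w := by
        have : colsum B w = colsum A w := Finset.sum_congr rfl fun u _ => (hw u).symm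
        omega
      have hB' := isAllocState_move hB hvw hBpos hE hltB
      have hBB' : DistMove E α β B (move B x v w) := ⟨hB, hB', x, v, w, hvw, hBpos, hltB, rfl⟩
      obtain ⟨m, hm, hm'⟩ := hv.of_le_off (A' := move A x v w) (v := v) (fun u t ht => by
        simp [move, ht])
      refine ihn m (by omega) _ _ hA' hB' (l1dist_move_move w hpos hBpos)
        (fun h => hAB (.head hAA' (h.trans (.single hBB'.symm)))) x₀ y v ?_ hv' (by tauto)
      have := move_sub_move w hpos hBpos x₀ y
      omega
    · have hvne : A x v ≠ B x v := by omega
      obtain ⟨u, hu⟩ := (full_of_ne ih hA hB hAB hvne).2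
      have hux : u ≠ x := by
        rintro rfl
        omega
      have hconn : ¬ Relation.ReflTransGen (DistMove E α β) (move A x v w) B :=
        fun h => hAB (.head hAA' h)
      have hd := l1dist_move_le (A := A) (B := B) (x := x) (y := v) (y' := w) (by omega)
      refine hv'.ne (full_of_ne (fun A' B' h1 h2 h3 => ih A' B' h1 h2 (h3.trans_le hd))
        hA' hB hconn (x := u) ?_).1
      simp only [move, hux, false_and, if_false]
      omega

/-- Under the strict Hall condition, every used column has a walk to a column with spare
capacity. -/
lemma exists_colWalk_of_hall [DecidableEq X] {E : X → X → Prop} [DecidableRel E] {α β : X → ℕ}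
    (hall : ∀ D : Finset X, D.Nonempty → ∑ x ∈ D, α x <
      ∑ y ∈ D.biUnion (fun x => Finset.univ.filter fun y => E x y), β y)
    {A : X → X → ℕ} (hA : IsAllocState E α β A) {x y : X} (hxy : 0 < A x y) :
    ∃ n w, ColWalk E A n y w ∧ colsum A w < β w := by
  by_contra! hfull
  set R : Finset X := Finset.univ.filter fun w => ∃ n, ColWalk E A n y w with hR
  set D : Finset X := Finset.univ.filter fun u => ∃ w ∈ R, 0 < A u w with hD
  have hyR : y ∈ R := by simpa [hR] using ⟨0, rfl⟩
  have hx : x ∈ D := by simpa [hD] using ⟨y, hyR, hxy⟩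
  have hsub : D.biUnion (fun x => Finset.univ.filter fun y => E x y) ⊆ R := by
    intro w hw
    simp only [Finset.mem_biUnion, Finset.mem_filter, Finset.mem_univ, true_and, hD, hR] at hw ⊢
    obtain ⟨u, ⟨t, ⟨n, hn⟩, hpos⟩, hE⟩ := hw
    exact ⟨n + 1, t, u, hn, hpos, hE⟩
  refine absurd (hall D ⟨x, hx⟩) (not_lt.2 ?_)
  calc ∑ y ∈ D.biUnion (fun x => Finset.univ.filter fun y => E x y), β y
      ≤ ∑ w ∈ R, β w := Finset.sum_le_sum_of_subset hsub
    _ ≤ ∑ w ∈ R, colsum A w := Finset.sum_le_sum fun w hw => by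
        obtain ⟨n, hn⟩ := (Finset.mem_filter.1 hw).2
        exact hfull n w hn
    _ = ∑ w ∈ R, ∑ u ∈ D, A u w := Finset.sum_congr rfl fun w hw => by
        refine (Finset.sum_subset (Finset.subset_univ D) fun u _ hu => ?_).symm
        by_contra h
        exact hu (Finset.mem_filter.2 ⟨Finset.mem_univ _, w, hw, Nat.pos_of_ne_zero h⟩)
    _ = ∑ u ∈ D, ∑ w ∈ R, A u w := Finset.sum_comm
    _ ≤ ∑ u ∈ D, α u := Finset.sum_le_sum fun u _ => by
        rw [← hA.2.1 u]
        exact Finset.sum_le_sum_of_subset (Finset.subset_univ R)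

/-- Connectivity of the distribution-move graph. -/
lemma reflTransGen_distMove [DecidableEq X] {E : X → X → Prop} [DecidableRel E] {α β : X → ℕ}
    (hall : ∀ D : Finset X, D.Nonempty → ∑ x ∈ D, α x <
      ∑ y ∈ D.biUnion (fun x => Finset.univ.filter fun y => E x y), β y)
    {A B : X → X → ℕ} (hA : IsAllocState E α β A) (hB : IsAllocState E α β B) :
    Relation.ReflTransGen (DistMove E α β) A B := by
  induction hd : l1dist A B using Nat.strong_induction_on generalizing A B with
  | _ d ih =>
  by_contra hAB
  have hne : A ≠ B := by
    rintro rfl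
    exact hAB .refl
  obtain ⟨x, y, hxy⟩ : ∃ x y, B x y < A x y := by
    by_contra! hle
    refine hne (funext fun x => funext fun y => (hle x y).antisymm ?_)
    by_contra! hlt
    obtain ⟨z, hz⟩ := exists_lt_of_sum_eq ((hA.2.1 x).trans (hB.2.1 x).symm) hlt
    exact absurd (hle x z) (not_le.2 hz)
  obtain ⟨n, w, hn, hw⟩ := exists_colWalk_of_hall hall hA (x := x) (y := y) (by omega)
  exact not_colWalk_of_ne (fun A' B' h1 h2 h3 => ih _ h3 h1 h2 rfl) n A B hA hB hd hAB x y w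
    hxy.ne' hw hn

/-- Complete allocation states exist under the Hall condition. -/
lemma exists_isAllocState [DecidableEq X] {E : X → X → Prop} [DecidableRel E] {α β : X → ℕ}
    (hall : ∀ D : Finset X, ∑ x ∈ D, α x ≤
      ∑ y ∈ D.biUnion (fun x => Finset.univ.filter fun y => E x y), β y) :
    ∃ W, IsAllocState E α β W := by
  let t : (Σ x, Fin (α x)) → Finset (Σ y, Fin (β y)) := fun p =>
    (Finset.univ.filter fun y => E p.1 y).sigma fun _ => Finset.univ
  have ht : ∀ s : Finset (Σ x, Fin (α x)), s.card ≤ (s.biUnion t).card := by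
    intro s
    have h1 : s ⊆ (s.image Sigma.fst).sigma fun _ => Finset.univ := fun p hp => by
      simpa using ⟨p.2, hp⟩
    have h2 : s.biUnion t = ((s.image Sigma.fst).biUnion
        (fun x => Finset.univ.filter fun y => E x y)).sigma fun _ => Finset.univ := by
      ext q
      simp [t]
    calc s.card ≤ _ := Finset.card_le_card h1
      _ = ∑ x ∈ s.image Sigma.fst, α x := by simp
      _ ≤ _ := hall _
      _ = _ := by rw [h2]; simp
  obtain ⟨f, hf, hft⟩ := (Finset.all_card_le_biUnion_card_iff_exists_injective t).1 ht
  refine ⟨fun x y => (Finset.univ.filter fun i : Fin (α x) => (f ⟨x, i⟩).1 = y).card,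
    fun x y hE => ?_, fun x => ?_, fun y => ?_⟩
  · rw [Finset.card_eq_zero, Finset.filter_eq_empty_iff]
    rintro i - rfl
    have := hft ⟨x, i⟩
    simp only [t, Finset.mem_sigma, Finset.mem_filter, Finset.mem_univ, true_and, and_true] at this
    exact hE this
  · rw [← Finset.card_eq_sum_card_fiberwise (fun i _ => Finset.mem_univ _)]
    simp
  · have h1 : colsum (fun x y => (Finset.univ.filter fun i : Fin (α x) =>
        (f ⟨x, i⟩).1 = y).card) y =
        ((Finset.univ : Finset X).sigma fun x => Finset.univ.filter fun i : Fin (α x) =>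
          (f ⟨x, i⟩).1 = y).card := by
      rw [Finset.card_sigma]
      rfl
    rw [h1]
    calc _ ≤ (({y} : Finset X).sigma fun y => (Finset.univ : Finset (Fin (β y)))).card := by
          refine Finset.card_le_card_of_injOn f (fun p hp => ?_) hf.injOn
          simpa using hp
      _ = β y := by simp

/-- A function that is harmonic for an irreducible finite stochastic matrix is constant. -/
lemma eq_of_harmonic {ι : Type*} {S : Finset ι} {p : ι → ι → ℝ}
    (hp : ∀ a b, 0 ≤ p a b) (hsum : ∀ a ∈ S, ∑ b ∈ S, p a b = 1)
    (hirr : ∀ a ∈ S, ∀ b ∈ S,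
      Relation.ReflTransGen (fun a b => a ∈ S ∧ b ∈ S ∧ 0 < p a b) a b)
    {r : ι → ℝ} (hr : ∀ a ∈ S, ∑ b ∈ S, p a b * r b = r a) :
    ∀ a ∈ S, ∀ b ∈ S, r a = r b := by
  intro a ha b hb
  obtain ⟨m, hm, hmax⟩ := S.exists_max_image r ⟨a, ha⟩
  have key : ∀ c, Relation.ReflTransGen (fun a b => a ∈ S ∧ b ∈ S ∧ 0 < p a b) m c →
      r c = r m := by
    intro c hc
    induction hc with
    | refl => rfl
    | @tail u v _ huv ih =>
      obtain ⟨hu, hv, hpos⟩ := huv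
      have h0 : ∑ w ∈ S, p u w * (r m - r w) = 0 := by
        simp only [mul_sub, Finset.sum_sub_distrib, ← Finset.sum_mul]
        rw [hsum u hu, hr u hu, ih]
        ring
      have h1 := (Finset.sum_eq_zero_iff_of_nonneg fun w hw =>
        mul_nonneg (hp u w) (sub_nonneg.2 (hmax w hw))).1 h0 v hv
      rcases mul_eq_zero.1 h1 with h2 | h2
      · exact absurd h2 hpos.ne'
      · linarith
  rw [key a (hirr m hm a ha), key b (hirr m hm b hb)]

/-- An irreducible finite stochastic matrix in detailed balance with a positive probability `μ` has
no other invariant probability. -/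
lemma eq_of_invariant_of_reversible {ι : Type*} {S : Finset ι} {p : ι → ι → ℝ}
    (hp : ∀ a b, 0 ≤ p a b) (hsum : ∀ a ∈ S, ∑ b ∈ S, p a b = 1)
    (hirr : ∀ a ∈ S, ∀ b ∈ S,
      Relation.ReflTransGen (fun a b => a ∈ S ∧ b ∈ S ∧ 0 < p a b) a b)
    {μ π : ι → ℝ} (hμ : ∀ a, 0 < μ a) (hμ1 : ∑ a ∈ S, μ a = 1)
    (hrev : ∀ a ∈ S, ∀ b ∈ S, μ a * p a b = μ b * p b a)
    (hπ1 : ∑ a ∈ S, π a = 1) (hπ : ∀ b ∈ S, ∑ a ∈ S, π a * p a b = π b) :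
    ∀ a ∈ S, π a = μ a := by
  intro a ha
  have hr : ∀ b ∈ S, ∑ c ∈ S, p b c * (π c / μ c) = π b / μ b := by
    intro b hb
    rw [eq_div_iff (hμ b).ne', Finset.sum_mul]
    rw [← hπ b hb]
    refine Finset.sum_congr rfl fun c hc => ?_
    have := hrev c hc b hb
    have hc0 := (hμ c).ne'
    field_simp
    linear_combination (-π c) * this
  have hconst := eq_of_harmonic hp hsum hirr (r := fun c => π c / μ c) hr
  have h1 : ∀ b ∈ S, π b = π a / μ a * μ b := fun b hb => by
    have := hconst a ha b hb
    rw [this, div_mul_cancel₀ _ (hμ b).ne']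
  have h2 : π a / μ a = 1 := by
    rw [← hπ1, Finset.sum_congr rfl h1, ← Finset.mul_sum, hμ1, mul_one]
  rwa [div_eq_one_iff_eq (hμ a).ne'] at h2

/-- Gibbs measures concentrate on the maximizers of the potential in the zero temperature limit. -/
lemma tendsto_gibbs {ι : Type*} {S : Finset ι} {a Ψ : ι → ℝ} (ha : ∀ i, 0 < a i) :
    ∀ w ∈ S, Filter.Tendsto
      (fun γ : ℝ => a w * Real.exp (γ * Ψ w) / ∑ i ∈ S, a i * Real.exp (γ * Ψ i))
      Filter.atTop (nhds (if ∀ i ∈ S, Ψ i ≤ Ψ w then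
        a w / ∑ i ∈ S.filter (fun i => ∀ j ∈ S, Ψ j ≤ Ψ i), a i else 0)) := by
  intro w hw
  obtain ⟨m, hm, hmax⟩ := S.exists_max_image Ψ ⟨w, hw⟩
  have hiff : ∀ i ∈ S, (∀ j ∈ S, Ψ j ≤ Ψ i) ↔ Ψ i = Ψ m := fun i hi =>
    ⟨fun h => (hmax i hi).antisymm (h m hm), fun h j hj => h ▸ hmax j hj⟩
  have hlim : ∀ i ∈ S, Filter.Tendsto (fun γ : ℝ => a i * Real.exp (γ * (Ψ i - Ψ m)))
      Filter.atTop (nhds (if ∀ j ∈ S, Ψ j ≤ Ψ i then a i else 0)) := by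
    intro i hi
    by_cases h : Ψ i = Ψ m
    · rw [if_pos ((hiff i hi).2 h), h]
      simp
    · rw [if_neg (fun h' => h ((hiff i hi).1 h'))]
      have hneg : Ψ i - Ψ m < 0 := sub_neg.2 (lt_of_le_of_ne (hmax i hi) h)
      have := (Real.tendsto_exp_atBot.comp
        (Filter.tendsto_id.atTop_mul_const_of_neg hneg)).const_mul (a i)
      simpa using this
  have hden := tendsto_finsetSum S hlim
  rw [← Finset.sum_filter] at hden
  have hpos : 0 < ∑ i ∈ S.filter (fun i => ∀ j ∈ S, Ψ j ≤ Ψ i), a i :=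
    Finset.sum_pos (fun i _ => ha i) ⟨m, Finset.mem_filter.2 ⟨hm, hmax⟩⟩
  have hquot := (hlim w hw).div hden hpos.ne'
  have heq : ∀ γ : ℝ, a w * Real.exp (γ * Ψ w) / ∑ i ∈ S, a i * Real.exp (γ * Ψ i) =
      a w * Real.exp (γ * (Ψ w - Ψ m)) / ∑ i ∈ S, a i * Real.exp (γ * (Ψ i - Ψ m)) := by
    intro γ
    have h1 : ∀ i, a i * Real.exp (γ * (Ψ i - Ψ m)) =
        a i * Real.exp (γ * Ψ i) * Real.exp (-(γ * Ψ m)) := fun i => by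
      rw [mul_assoc, ← Real.exp_add]
      ring_nf
    simp only [h1, ← Finset.sum_mul]
    rw [mul_div_mul_right _ _ (Real.exp_pos _).ne']
  simp only [heq]
  rwa [ite_div, zero_div] at hquot

/-- under the strict Hall condition, the chain restricted to
complete allocation states is irreducible (hence, being finite, ergodic),
time-reversible, with unique invariant probability
`μ_γ(W) = (α choose W) e^{γΨ(W)} / ∑_{W'} (α choose W') e^{γΨ(W')}`; and as
`γ → ∞`, `μ_γ` converges to `μ_∞` supported on the maximizers of `Ψ` with
`μ_∞(W) ∝ (α choose W)`. -/
theorem ergodic_reversible_limit [DecidableEq X]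
    (E : X → X → Prop) [DecidableRel E] (α β : X → ℕ)
    (lam : X → ℝ) (kc ka : ℝ) (ν : X → ℝ)
    (hall : ∀ D : Finset X, D.Nonempty → ∑ x ∈ D, α x <
      ∑ y ∈ D.biUnion (fun x => Finset.univ.filter fun y => E x y), β y)
    (hν : ∀ x, 0 < ν x)
    (S : Finset (X → X → ℕ)) (hS : ∀ W, W ∈ S ↔ IsAllocState E α β W)
    (Z : ℝ → (X → X → ℕ) → X → ℝ) (hZ : ∀ γ W x, 0 < Z γ W x)
    (P : ℝ → (X → X → ℕ) → (X → X → ℕ) → ℝ)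
    (hPnonneg : ∀ γ W W', 0 ≤ P γ W W')
    (hPstoch : ∀ γ, ∀ W ∈ S, ∑ W' ∈ S, P γ W W' = 1)
    (hPzero : ∀ γ, ∀ W ∈ S, ∀ W' ∈ S, W ≠ W' →
      (¬ ∃ x y y', y ≠ y' ∧ 0 < W x y ∧ W' = move W x y y') → P γ W W' = 0)
    (hPform : ∀ γ, ∀ W ∈ S, ∀ x y y' : X, y ≠ y' → 0 < W x y →
      colsum W y' < β y' →
      P γ W (move W x y y') =
        ν x * (W x y : ℝ) / (α x : ℝ) *
          Real.exp (γ * payoff lam kc ka β (move W x y y') x y') /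
            Z γ (remove W x y) x) :
    let μ : ℝ → (X → X → ℕ) → ℝ := fun γ W =>
      multi α W * Real.exp (γ * potential lam kc ka β W) /
        ∑ W' ∈ S, multi α W' * Real.exp (γ * potential lam kc ka β W')
    -- irreducibility (ergodicity on the finite state space S)
    (∀ γ : ℝ, ∀ W ∈ S, ∀ W' ∈ S,
      Relation.ReflTransGen (fun A B => A ∈ S ∧ B ∈ S ∧ 0 < P γ A B) W W') ∧
    -- time-reversibility (detailed balance) for μ_γ
    (∀ γ : ℝ, ∀ W ∈ S, ∀ W' ∈ S, μ γ W * P γ W W' = μ γ W' * P γ W' W) ∧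
    -- μ_γ is an invariant probability
    (∀ γ : ℝ, (∑ W ∈ S, μ γ W = 1) ∧
      ∀ W' ∈ S, ∑ W ∈ S, μ γ W * P γ W W' = μ γ W') ∧
    -- uniqueness of the invariant probability
    (∀ γ : ℝ, ∀ π : (X → X → ℕ) → ℝ, (∀ W ∈ S, 0 ≤ π W) →
      (∑ W ∈ S, π W = 1) → (∀ W' ∈ S, ∑ W ∈ S, π W * P γ W W' = π W') →
      ∀ W ∈ S, π W = μ γ W) ∧
    -- convergence to μ_∞ concentrated on the maximizers of Ψ
    (∀ W ∈ S, Filter.Tendsto (fun γ => μ γ W) Filter.atTop (nhds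
      (if ∀ V ∈ S, potential lam kc ka β V ≤ potential lam kc ka β W then
        multi α W /
          ∑ W' ∈ S.filter (fun V => ∀ V' ∈ S,
            potential lam kc ka β V' ≤ potential lam kc ka β V), multi α W'
      else 0))) := by
  intro μ
  have hne : S.Nonempty := by
    obtain ⟨W, hW⟩ := exists_isAllocState (E := E) (α := α) (β := β) fun D => by
      rcases D.eq_empty_or_nonempty with rfl | hD
      · simp
      · exact (hall D hD).le
    exact ⟨W, (hS W).2 hW⟩
  have hwpos : ∀ γ W, 0 < multi α W * Real.exp (γ * potential lam kc ka β W) := fun γ W =>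
    mul_pos (multi_pos α W) (Real.exp_pos _)
  have hZpos : ∀ γ, 0 < ∑ W ∈ S, multi α W * Real.exp (γ * potential lam kc ka β W) := fun γ =>
    Finset.sum_pos (fun W _ => hwpos γ W) hne
  have hμpos : ∀ γ W, 0 < μ γ W := fun γ W => div_pos (hwpos γ W) (hZpos γ)
  have hμ1 : ∀ γ, ∑ W ∈ S, μ γ W = 1 := fun γ => by
    simp only [μ, ← Finset.sum_div]
    exact div_self (hZpos γ).ne'
  have hirr : ∀ γ : ℝ, ∀ W ∈ S, ∀ W' ∈ S,
      Relation.ReflTransGen (fun A B => A ∈ S ∧ B ∈ S ∧ 0 < P γ A B) W W' := by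
    intro γ W hW W' hW'
    refine Relation.ReflTransGen.mono ?_ _ _
      (reflTransGen_distMove hall ((hS W).1 hW) ((hS W').1 hW'))
    rintro A B ⟨hA, hB, x, y, y', hy, hpos, hc, rfl⟩
    refine ⟨(hS A).2 hA, (hS _).2 hB, ?_⟩
    rw [hPform γ A ((hS A).2 hA) x y y' hy hpos hc]
    have hα : 0 < α x := by
      rw [← hA.2.1 x]
      exact hpos.trans_le (Finset.single_le_sum (fun _ _ => Nat.zero_le _) (Finset.mem_univ y))
    have := hν x
    have := hZ γ (remove A x y) x
    positivity
  have hrevMove : ∀ γ W, W ∈ S → ∀ x y y', move W x y y' ∈ S → y ≠ y' → 0 < W x y →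
      μ γ W * P γ W (move W x y y') = μ γ (move W x y y') * P γ (move W x y y') W := by
    intro γ W hW x y y' hW' hy hpos
    have hpos' : 0 < move W x y y' x y' := by
      rw [move_apply_self _ hy]
      omega
    have h1 := hPform γ W hW x y y' hy hpos
      (colsum_lt_of_isAllocState_move ((hS _).1 hW') hy hpos)
    have h2 := hPform γ _ hW' x y' y hy.symm hpos' (colsum_move_lt ((hS W).1 hW) hy hpos)
    rw [move_move _ hpos, remove_move] at h2
    have hΨ1 := potential_addUnit lam kc ka β (remove W x y) x y
    have hΨ2 := potential_addUnit lam kc ka β (remove W x y) x y'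
    have hm1 := multi_addUnit α (remove W x y) x y
    have hm2 := multi_addUnit α (remove W x y) x y'
    rw [addUnit_remove hpos] at hΨ1 hm1
    rw [← move_eq_addUnit_remove] at hΨ2 hm2
    rw [h1, h2]
    simp only [μ]
    rw [hΨ1, hΨ2, mul_add, mul_add, Real.exp_add, Real.exp_add]
    generalize Real.exp (γ * potential lam kc ka β (remove W x y)) = e
    generalize Real.exp (γ * payoff lam kc ka β W x y) = e1
    generalize Real.exp (γ * payoff lam kc ka β (move W x y y') x y') = e2
    generalize (∑ W' ∈ S, multi α W' * Real.exp (γ * potential lam kc ka β W')) = s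
    linear_combination (e * e1 * e2 * ν x / α x / Z γ (remove W x y) x / s) * (hm1 - hm2)
  have hrev : ∀ γ : ℝ, ∀ W ∈ S, ∀ W' ∈ S, μ γ W * P γ W W' = μ γ W' * P γ W' W := by
    intro γ W hW W' hW'
    by_cases hWW : W = W'
    · rw [hWW]
    by_cases hmv : ∃ x y y', y ≠ y' ∧ 0 < W x y ∧ W' = move W x y y'
    · obtain ⟨x, y, y', hy, hpos, rfl⟩ := hmv
      exact hrevMove γ W hW x y y' hW' hy hpos
    by_cases hmv' : ∃ x y y', y ≠ y' ∧ 0 < W' x y ∧ W = move W' x y y'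
    · obtain ⟨x, y, y', hy, hpos, rfl⟩ := hmv'
      exact (hrevMove γ W' hW' x y y' hW hy hpos).symm
    rw [hPzero γ W hW W' hW' hWW hmv, hPzero γ W' hW' W hW (Ne.symm hWW) hmv', mul_zero, mul_zero]
  refine ⟨hirr, hrev, fun γ => ⟨hμ1 γ, fun W' hW' => ?_⟩, ?_, ?_⟩
  · rw [Finset.sum_congr rfl fun W hW => hrev γ W hW W' hW', ← Finset.mul_sum, hPstoch γ W' hW',
      mul_one]
  · intro γ π _ hπ1 hπ
    exact eq_of_invariant_of_reversible (hPnonneg γ) (hPstoch γ) (hirr γ) (hμpos γ) (hμ1 γ)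
      (hrev γ) hπ1 hπ
  · exact tendsto_gibbs (multi_pos α)
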